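/- If G is an apex simple graph on 13 vertices with minimum degree at least 6, then G is isomorphic to the join K1 ∗ Ic of a single vertex with the icosahedral graph. -/

import Mathlib

open SimpleGraph

/-- `H` is a minor of `G`: there is an assignment of (some) vertices of `G` to
branch sets, one nonempty connected branch set for each vertex of `H`, such that
every edge of `H` is realized by an edge of `G` between the corresponding branch sets. -/
def IsMinor {V W : Type} (H : SimpleGraph W) (G : SimpleGraph V) : Prop :=
  ∃ f : V → Option W,
    (∀ w : W, ∃ v, f v = some w) ∧
    (∀ w : W, (G.induce {v | f v = some w}).Connected) ∧
    (∀ w₁ w₂ : W, H.Adj w₁ w₂ →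
      ∃ v₁ v₂, f v₁ = some w₁ ∧ f v₂ = some w₂ ∧ G.Adj v₁ v₂)

/-- Planarity via Wagner's theorem: no `K₅` minor and no `K₃,₃` minor. -/
def IsPlanar {V : Type} (G : SimpleGraph V) : Prop :=
  ¬ IsMinor (completeGraph (Fin 5)) G ∧
    ¬ IsMinor (completeBipartiteGraph (Fin 3) (Fin 3)) G

/-- A graph is apex if deleting some vertex leaves a planar graph. -/
def IsApex {V : Type} (G : SimpleGraph V) : Prop :=
  ∃ v : V, IsPlanar (G.induce {u | u ≠ v})

/-- Minor minimal non-apex: not apex, but every proper minor is apex. -/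
def IsMMNA {V : Type} (G : SimpleGraph V) : Prop :=
  ¬ IsApex G ∧
    ∀ (W : Type) (H : SimpleGraph W), IsMinor H G → ¬ IsMinor G H → IsApex H

/-- The degree of a vertex, as the cardinality of its neighbor set. -/
noncomputable def vdeg {V : Type} (G : SimpleGraph V) (v : V) : ℕ :=
  (G.neighborSet v).ncard

/-- Edge list of the icosahedral graph on 12 vertices. -/
def icList : List (Fin 12 × Fin 12) :=
  [(0,1),(0,2),(0,3),(0,4),(0,5),
   (1,2),(2,3),(3,4),(4,5),(5,1),
   (11,6),(11,7),(11,8),(11,9),(11,10),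
   (6,7),(7,8),(8,9),(9,10),(10,6),
   (1,6),(1,7),(2,7),(2,8),(3,8),(3,9),(4,9),(4,10),(5,10),(5,6)]

/-- The icosahedral graph `Ic`. -/
def Ic : SimpleGraph (Fin 12) := SimpleGraph.fromRel (fun a b => (a, b) ∈ icList)

/-- The join `K₁ ∗ Ic`: a cone over the icosahedral graph. -/
def ConeIc : SimpleGraph (Unit ⊕ Fin 12) :=
  SimpleGraph.fromRel (fun a b =>
    a = Sum.inl () ∨ b = Sum.inl () ∨ ∃ x y, a = Sum.inr x ∧ b = Sum.inr y ∧ Ic.Adj x y)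

section Density

open scoped Classical
open Finset

variable {V W : Type}

/-- A set of vertices is connected when every property that propagates along the edges inside
the set and holds somewhere in the set holds everywhere in it. -/
def ConnectedOn (G : SimpleGraph V) (B : Set V) : Prop :=
  ∀ P : V → Prop, (∃ x ∈ B, P x) → (∀ x ∈ B, ∀ y ∈ B, G.Adj x y → P x → P y) → ∀ y ∈ B, P y

/-- `K` has a minor model in `G` whose branch sets lie inside `S`. -/
def HasModel (K : SimpleGraph W) (G : SimpleGraph V) (S : Finset V) : Prop :=
  ∃ B : W → Set V, (∀ w, B w ⊆ S) ∧ (∀ w, (B w).Nonempty) ∧ (∀ w, ConnectedOn G (B w)) ∧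
    (∀ w w', w ≠ w' → ∀ x ∈ B w, x ∉ B w') ∧
    ∀ w w', K.Adj w w' → ∃ x ∈ B w, ∃ y ∈ B w', G.Adj x y

lemma connectedOn_singleton (G : SimpleGraph V) (x : V) : ConnectedOn G {x} := by
  rintro P ⟨y, rfl, hy⟩ _ z rfl
  exact hy

lemma connectedOn_pair {G : SimpleGraph V} {x y : V} (h : G.Adj x y) :
    ConnectedOn G {x, y} := by
  rintro P ⟨z, hz, hP⟩ hprop
  have hxy := hprop x (by simp) y (by simp) h
  have hyx := hprop y (by simp) x (by simp) h.symm
  rintro w (rfl | rfl) <;> rcases hz with rfl | rfl <;> tauto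

lemma ConnectedOn.connected_induce {G : SimpleGraph V} {B : Set V} (h : ConnectedOn G B)
    (hne : B.Nonempty) : (G.induce B).Connected := by
  obtain ⟨x, hx⟩ := hne
  have : Nonempty B := ⟨⟨x, hx⟩⟩
  rw [SimpleGraph.connected_iff_exists_forall_reachable]
  refine ⟨⟨x, hx⟩, fun ⟨y, hy⟩ => ?_⟩
  have := h (fun z => ∃ hz : z ∈ B, (G.induce B).Reachable ⟨x, hx⟩ ⟨z, hz⟩)
    ⟨x, hx, hx, SimpleGraph.Reachable.refl _⟩ ?_ y hy
  · exact this.2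
  · rintro a ha b hb hab ⟨_, hr⟩
    exact ⟨hb, hr.trans (SimpleGraph.Adj.reachable (by simpa using hab))⟩

lemma HasModel.isMinor {K : SimpleGraph W} {G : SimpleGraph V} {S : Finset V}
    (h : HasModel K G S) : IsMinor K G := by
  obtain ⟨B, -, hne, hconn, hdisj, hadj⟩ := h
  have hf : ∀ x w, (if hx : ∃ w, x ∈ B w then some hx.choose else none) = some w ↔ x ∈ B w := by
    intro x w
    constructor
    · intro hx
      split_ifs at hx with h1
      · have h2 := h1.choose_spec
        rwa [Option.some.inj hx] at h2
    · intro hx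
      have h1 : ∃ w, x ∈ B w := ⟨w, hx⟩
      rw [dif_pos h1]
      by_contra hne
      exact hdisj _ _ (fun he => hne (congrArg some he)) x h1.choose_spec hx
  refine ⟨fun x => if hx : ∃ w, x ∈ B w then some hx.choose else none, ?_, ?_, ?_⟩
  · intro w
    obtain ⟨x, hx⟩ := hne w
    exact ⟨x, (hf x w).2 hx⟩
  · intro w
    have : {v | (if hx : ∃ w, v ∈ B w then some hx.choose else none) = some w} = B w :=
      Set.ext fun x => hf x w
    rw [this]
    exact (hconn w).connected_induce (hne w)
  · intro w₁ w₂ h12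
    obtain ⟨x, hx, y, hy, hxy⟩ := hadj w₁ w₂ h12
    exact ⟨x, y, (hf x w₁).2 hx, (hf y w₂).2 hy, hxy⟩

lemma HasModel.mono {K : SimpleGraph W} {G G' : SimpleGraph V} {S S' : Finset V}
    (h : HasModel K G S) (hG : G ≤ G') (hS : S ⊆ S') : HasModel K G' S' := by
  obtain ⟨B, hsub, hne, hconn, hdisj, hadj⟩ := h
  refine ⟨B, fun w => (hsub w).trans (by exact_mod_cast hS), hne,
    fun w P hP hprop => hconn w P hP fun x hx y hy hxy => hprop x hx y hy (hG hxy), hdisj, ?_⟩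
  intro w w' hw
  obtain ⟨x, hx, y, hy, hxy⟩ := hadj w w' hw
  exact ⟨x, hx, y, hy, hG hxy⟩

/-- The graph obtained from `G` by giving to `v` all neighbors of `u`: restricted to the vertices
other than `u`, this is the contraction of the edge `uv`. -/
def contractInto (G : SimpleGraph V) (u v : V) : SimpleGraph V where
  Adj x y := x ≠ y ∧ (G.Adj x y ∨ (x = v ∧ G.Adj u y) ∨ (y = v ∧ G.Adj u x))
  symm := ⟨fun x y h => ⟨h.1.symm, by rcases h.2 with h | h | h <;> simp_all [G.adj_comm]⟩⟩
  loopless := ⟨fun x h => h.1 rfl⟩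

lemma HasModel.of_contractInto {K : SimpleGraph W} {G : SimpleGraph V} {S : Finset V} {u v : V}
    (huv : G.Adj u v) (hu : u ∈ S) (h : HasModel K (contractInto G u v) (S.erase u)) :
    HasModel K G S := by
  obtain ⟨B, hsub, hne, hconn, hdisj, hadj⟩ := h
  have huB : ∀ w, u ∉ B w := fun w hw => by simpa using hsub w hw
  refine ⟨fun w => {x | x ∈ B w ∨ (x = u ∧ v ∈ B w)}, ?_, ?_, ?_, ?_, ?_⟩
  · rintro w x (hx | ⟨rfl, -⟩)
    · exact Finset.mem_of_mem_erase (hsub w hx)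
    · exact hu
  · intro w
    obtain ⟨x, hx⟩ := hne w
    exact ⟨x, Or.inl hx⟩
  · rintro w P ⟨x, hx, hPx⟩ hprop
    have key : ∀ y ∈ B w, P y := by
      refine hconn w P ?_ ?_
      · rcases hx with hx | ⟨rfl, hv⟩
        · exact ⟨x, hx, hPx⟩
        · exact ⟨v, hv, hprop _ (Or.inr ⟨rfl, hv⟩) _ (Or.inl hv) huv hPx⟩
      · rintro a ha b hb ⟨-, hab | ⟨rfl, hab⟩ | ⟨rfl, hab⟩⟩ hPa
        · exact hprop _ (Or.inl ha) _ (Or.inl hb) hab hPa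
        · exact hprop u (Or.inr ⟨rfl, ha⟩) _ (Or.inl hb) hab
            (hprop _ (Or.inl ha) u (Or.inr ⟨rfl, ha⟩) huv.symm hPa)
        · exact hprop u (Or.inr ⟨rfl, hb⟩) _ (Or.inl hb) huv
            (hprop _ (Or.inl ha) u (Or.inr ⟨rfl, hb⟩) hab.symm hPa)
    rintro y (hy | ⟨rfl, hv⟩)
    · exact key y hy
    · exact hprop v (Or.inl hv) y (Or.inr ⟨rfl, hv⟩) huv.symm (key v hv)
  · rintro w w' hw x (hx | ⟨rfl, hv⟩) (hx' | ⟨hxu, hv'⟩)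
    · exact hdisj w w' hw x hx hx'
    · exact huB w (hxu ▸ hx)
    · exact huB w' hx'
    · exact hdisj w w' hw v hv hv'
  · intro w w' hw
    obtain ⟨x, hx, y, hy, -, hxy | ⟨rfl, hxy⟩ | ⟨rfl, hxy⟩⟩ := hadj w w' hw
    · exact ⟨x, Or.inl hx, y, Or.inl hy, hxy⟩
    · exact ⟨u, Or.inr ⟨rfl, hx⟩, y, Or.inl hy, hxy⟩
    · exact ⟨x, Or.inl hx, u, Or.inr ⟨rfl, hy⟩, hxy.symm⟩

/-- Three mutually adjacent vertices and two connected sets, all pairwise joined by edges, form a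
model of `K₅`. -/
lemma hasModel_completeGraph_five {G : SimpleGraph V} {S : Finset V} {p q r : V} {X Y : Set V}
    (hp : p ∈ S) (hq : q ∈ S) (hr : r ∈ S) (hX : X ⊆ S) (hY : Y ⊆ S)
    (hpq : G.Adj p q) (hpr : G.Adj p r) (hqr : G.Adj q r)
    (hXc : ConnectedOn G X) (hYc : ConnectedOn G Y) (hXY : ∀ x ∈ X, x ∉ Y)
    (hpX : p ∉ X) (hqX : q ∉ X) (hrX : r ∉ X) (hpY : p ∉ Y) (hqY : q ∉ Y) (hrY : r ∉ Y)
    (apX : ∃ x ∈ X, G.Adj p x) (aqX : ∃ x ∈ X, G.Adj q x) (arX : ∃ x ∈ X, G.Adj r x)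
    (apY : ∃ y ∈ Y, G.Adj p y) (aqY : ∃ y ∈ Y, G.Adj q y) (arY : ∃ y ∈ Y, G.Adj r y)
    (aXY : ∃ x ∈ X, ∃ y ∈ Y, G.Adj x y) :
    HasModel (completeGraph (Fin 5)) G S := by
  have aYX : ∃ y ∈ Y, ∃ x ∈ X, G.Adj y x := by
    obtain ⟨x, hx, y, hy, h⟩ := aXY
    exact ⟨y, hy, x, hx, h.symm⟩
  have hYX : ∀ y ∈ Y, y ∉ X := fun y hy hx => hXY y hx hy
  refine ⟨![{p}, {q}, {r}, X, Y], ?_, ?_, ?_, ?_, ?_⟩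
  · intro w
    fin_cases w <;> simp [*]
  · intro w
    fin_cases w <;> simp
    · exact apX.imp fun _ h => h.1
    · exact apY.imp fun _ h => h.1
  · intro w
    fin_cases w <;> simp [*, connectedOn_singleton]
  · intro w w' hw
    fin_cases w <;> fin_cases w' <;> simp at hw <;> simp [*, hpq.ne, hpr.ne, hqr.ne,
      hpq.ne', hpr.ne', hqr.ne'] <;> intro x hx h <;>
      first | exact hXY x hx h | exact hYX x hx h | (subst h; contradiction)
  · intro w w' hw
    fin_cases w <;> fin_cases w' <;> simp at hw <;>
      simp [*, hpq.symm, hpr.symm, hqr.symm] <;>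
      first
        | simpa [G.adj_comm] using apX
        | simpa [G.adj_comm] using aqX
        | simpa [G.adj_comm] using arX
        | simpa [G.adj_comm] using apY
        | simpa [G.adj_comm] using aqY
        | simpa [G.adj_comm] using arY

lemma hasModel_completeGraph_five_of_clique {G : SimpleGraph V} {S : Finset V} {p q r x y : V}
    (hp : p ∈ S) (hq : q ∈ S) (hr : r ∈ S) (hx : x ∈ S) (hy : y ∈ S)
    (hpq : G.Adj p q) (hpr : G.Adj p r) (hpx : G.Adj p x) (hpy : G.Adj p y) (hqr : G.Adj q r)
    (hqx : G.Adj q x) (hqy : G.Adj q y) (hrx : G.Adj r x) (hry : G.Adj r y) (hxy : G.Adj x y) :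
    HasModel (completeGraph (Fin 5)) G S := by
  apply hasModel_completeGraph_five hp hq hr (X := {x}) (Y := {y}) <;>
    simp [*, connectedOn_singleton, hpx.ne, hpy.ne, hqx.ne, hqy.ne, hrx.ne, hry.ne, hxy.ne]

/-- The neighbors of `x` in `S`. -/
noncomputable def nbrs (G : SimpleGraph V) (S : Finset V) (x : V) : Finset V :=
  {y ∈ S | G.Adj x y}

/-- Twice the number of edges of `G` inside `S`. -/
noncomputable def degSum (G : SimpleGraph V) (S : Finset V) : ℕ :=
  ∑ x ∈ S, #(nbrs G S x)

lemma mem_nbrs {G : SimpleGraph V} {S : Finset V} {x y : V} :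
    y ∈ nbrs G S x ↔ y ∈ S ∧ G.Adj x y := by
  simp [nbrs]

lemma degSum_mono {G G' : SimpleGraph V} {S : Finset V}
    (h : ∀ x ∈ S, ∀ y ∈ S, G.Adj x y → G'.Adj x y) : degSum G S ≤ degSum G' S := by
  refine Finset.sum_le_sum fun x hx => Finset.card_le_card fun y hy => ?_
  rw [mem_nbrs] at hy ⊢
  exact ⟨hy.1, h x hx y hy.1 hy.2⟩

lemma degSum_erase (G : SimpleGraph V) {S : Finset V} {u : V} (hu : u ∈ S) :
    degSum G S = degSum G (S.erase u) + 2 * #(nbrs G S u) := by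
  have h1 : ∀ x ∈ S.erase u,
      #(nbrs G S x) = #(nbrs G (S.erase u) x) + if G.Adj u x then 1 else 0 := by
    intro x hx
    split_ifs with h
    · have : nbrs G S x = insert u (nbrs G (S.erase u) x) := by
        ext y
        simp only [mem_nbrs, Finset.mem_insert, Finset.mem_erase]
        by_cases hy : y = u
        · subst hy
          simp [hu, h.symm]
        · simp [hy]
      rw [this, Finset.card_insert_of_notMem (by simp [mem_nbrs])]
    · congr 1
      ext y
      simp only [mem_nbrs, Finset.mem_erase]
      constructor
      · rintro ⟨hy, hxy⟩
        exact ⟨⟨fun he => h (he ▸ hxy.symm), hy⟩, hxy⟩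
      · rintro ⟨⟨-, hy⟩, hxy⟩
        exact ⟨hy, hxy⟩
  have h2 : #(nbrs G S u) = ∑ x ∈ S.erase u, if G.Adj u x then 1 else 0 := by
    rw [← Finset.card_filter]
    congr 1
    ext y
    simp only [mem_nbrs, Finset.mem_filter, Finset.mem_erase]
    exact ⟨fun h => ⟨⟨h.2.ne', h.1⟩, h.2⟩, fun h => ⟨h.1.2, h.2⟩⟩
  rw [degSum, ← Finset.add_sum_erase _ _ hu, Finset.sum_congr rfl h1, Finset.sum_add_distrib,
    ← h2, degSum]
  ring

lemma degSum_le_contractInto {G : SimpleGraph V} {S : Finset V} {u v : V} (hu : u ∈ S)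
    (hv : v ∈ S) (huv : G.Adj u v) :
    degSum G S ≤
      degSum (contractInto G u v) (S.erase u) + 2 + 2 * #(nbrs G S u ∩ nbrs G S v) := by
  have hv' : v ∈ S.erase u := Finset.mem_erase.2 ⟨huv.ne', hv⟩
  rw [degSum_erase G hu, degSum_erase G hv', degSum_erase (contractInto G u v) hv']
  have hmono : degSum G ((S.erase u).erase v) ≤
      degSum (contractInto G u v) ((S.erase u).erase v) :=
    degSum_mono fun x _ y _ h => ⟨h.ne, Or.inl h⟩
  have hcard := Finset.card_union_add_card_inter (nbrs G S u) (nbrs G (S.erase u) v)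
  have hunion : #(nbrs G S u ∪ nbrs G (S.erase u) v) ≤
      #(nbrs (contractInto G u v) (S.erase u) v) + 1 := by
    refine le_trans (Finset.card_le_card fun y hy => ?_)
      (Finset.card_insert_le v (nbrs (contractInto G u v) (S.erase u) v))
    simp only [mem_nbrs, Finset.mem_union, Finset.mem_insert, Finset.mem_erase] at hy ⊢
    by_cases hyv : y = v
    · exact Or.inl hyv
    · right
      rcases hy with hy | hy
      · exact ⟨⟨hy.2.ne', hy.1⟩, Ne.symm hyv, Or.inr (Or.inl ⟨rfl, hy.2⟩)⟩
      · exact ⟨hy.1, Ne.symm hyv, Or.inl hy.2⟩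
  have hinter : #(nbrs G S u ∩ nbrs G (S.erase u) v) ≤ #(nbrs G S u ∩ nbrs G S v) := by
    refine Finset.card_le_card fun y hy => ?_
    simp only [mem_nbrs, Finset.mem_inter, Finset.mem_erase] at hy ⊢
    exact ⟨hy.1, hy.2.1.2, hy.2.2⟩
  omega

lemma degSum_le_deleteEdge {G : SimpleGraph V} {S : Finset V} {x y : V} (hx : x ∈ S) (hy : y ∈ S)
    (h : G.Adj x y) :
    degSum G S ≤ degSum (G.deleteEdges {s(x, y)}) S + 2 ∧
      degSum (G.deleteEdges {s(x, y)}) S < degSum G S := by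
  rw [degSum_erase G hx, degSum_erase (G.deleteEdges {s(x, y)}) hx]
  have h1 : degSum G (S.erase x) ≤ degSum (G.deleteEdges {s(x, y)}) (S.erase x) := by
    refine degSum_mono fun a ha b hb hab => ?_
    simp only [Finset.mem_erase] at ha hb
    simp [hab, ha.1, hb.1]
  have h2 : degSum (G.deleteEdges {s(x, y)}) (S.erase x) ≤ degSum G (S.erase x) :=
    degSum_mono fun a _ b _ hab => (SimpleGraph.deleteEdges_le _) hab
  have h3 : nbrs G S x = insert y (nbrs (G.deleteEdges {s(x, y)}) S x) := by
    ext z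
    by_cases hz : z = y
    · subst hz
      simp [mem_nbrs, hy, h]
    · simp only [mem_nbrs, Finset.mem_insert, hz, false_or, SimpleGraph.deleteEdges_adj]
      simp [hz, h.ne]
  have h4 : y ∉ nbrs (G.deleteEdges {s(x, y)}) S x := by simp [mem_nbrs]
  rw [h3, Finset.card_insert_of_notMem h4]
  omega

/-- A vertex of degree `4` or `5` all of whose edges lie in at least three triangles yields a
`K₅` minor. -/
lemma hasModel_of_three_le_common {G : SimpleGraph V} {S : Finset V} {u : V} (hu : u ∈ S)
    (hlow : 4 ≤ #(nbrs G S u)) (hup : #(nbrs G S u) ≤ 5)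
    (hcommon : ∀ v ∈ nbrs G S u, 3 ≤ #(nbrs G S u ∩ nbrs G S v)) :
    HasModel (completeGraph (Fin 5)) G S := by
  have hnon : ∀ v ∈ nbrs G S u, ∀ T ⊆ nbrs G S u, v ∉ T → (∀ x ∈ T, ¬ G.Adj v x) →
      #T + 4 ≤ #(nbrs G S u) := by
    intro v hv T hT hvT hadj
    have hsub : insert v T ∪ (nbrs G S u ∩ nbrs G S v) ⊆ nbrs G S u := by
      intro x hx
      simp only [Finset.mem_union, Finset.mem_insert, Finset.mem_inter] at hx
      rcases hx with (rfl | hx) | hx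
      · exact hv
      · exact hT hx
      · exact hx.1
    have hdis : Disjoint (insert v T) (nbrs G S u ∩ nbrs G S v) := by
      rw [Finset.disjoint_left]
      intro x hx hx'
      simp only [Finset.mem_insert, Finset.mem_inter, mem_nbrs] at hx hx'
      rcases hx with rfl | hx
      · exact G.loopless.irrefl _ hx'.2.2
      · exact hadj x hx hx'.2.2
    have h1 := Finset.card_le_card hsub
    rw [Finset.card_union_of_disjoint hdis, Finset.card_insert_of_notMem hvT] at h1
    have := hcommon v hv
    omega
  have hS : ∀ x ∈ nbrs G S u, x ∈ S := fun x hx => (mem_nbrs.1 hx).1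
  have hA : ∀ x ∈ nbrs G S u, G.Adj u x := fun x hx => (mem_nbrs.1 hx).2
  by_cases hclique : ∀ x ∈ nbrs G S u, ∀ y ∈ nbrs G S u, x ≠ y → G.Adj x y
  · obtain ⟨T, hT, hTc⟩ := Finset.exists_subset_card_eq hlow
    obtain ⟨a, b, c, d, hab, hac, had, hbc, hbd, hcd, rfl⟩ := Finset.card_eq_four.1 hTc
    have ha := hT (show a ∈ _ by simp)
    have hb := hT (show b ∈ _ by simp)
    have hc := hT (show c ∈ _ by simp)
    have hd := hT (show d ∈ _ by simp)
    exact hasModel_completeGraph_five_of_clique hu (hS _ ha) (hS _ hb) (hS _ hc) (hS _ hd)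
      (hA _ ha) (hA _ hb) (hA _ hc) (hA _ hd) (hclique _ ha _ hb hab) (hclique _ ha _ hc hac)
      (hclique _ ha _ hd had) (hclique _ hb _ hc hbc) (hclique _ hb _ hd hbd)
      (hclique _ hc _ hd hcd)
  · push Not at hclique
    obtain ⟨a, ha, b, hb, hab, hnab⟩ := hclique
    have h5 : #(nbrs G S u) = 5 := by
      have := hnon a ha {b} (by simpa using hb) (by simpa using hab) (by simpa using hnab)
      simp at this
      omega
    have huniq : ∀ x ∈ nbrs G S u, ∀ y ∈ nbrs G S u, ∀ z ∈ nbrs G S u, x ≠ y → x ≠ z → y ≠ z →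
        ¬ G.Adj x y → G.Adj x z := by
      intro x hx y hy z hz hxy hxz hyz hnxy
      by_contra hnxz
      have := hnon x hx {y, z} (by simp [Finset.insert_subset_iff, hy, hz]) (by simp [hxy, hxz])
        (by simp [hnxy, hnxz])
      rw [Finset.card_pair hyz] at this
      omega
    have hrest : #(((nbrs G S u).erase a).erase b) = 3 := by
      rw [Finset.card_erase_of_mem (by simp [hb, hab.symm]), Finset.card_erase_of_mem ha, h5]
    have hmem : ∀ x, x ∈ ((nbrs G S u).erase a).erase b →
        x ∈ nbrs G S u ∧ G.Adj a x ∧ G.Adj b x := by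
      intro x hx
      simp only [Finset.mem_erase] at hx
      exact ⟨hx.2.2, huniq a ha b hb x hx.2.2 hab hx.2.1.symm hx.1.symm hnab,
        huniq b hb a ha x hx.2.2 hab.symm hx.1.symm hx.2.1.symm fun h => hnab h.symm⟩
    by_cases hcl : ∀ x ∈ ((nbrs G S u).erase a).erase b,
        ∀ y ∈ ((nbrs G S u).erase a).erase b, x ≠ y → G.Adj x y
    · obtain ⟨c, d, e, hcd, hce, hde, hT⟩ := Finset.card_eq_three.1 hrest
      rw [hT] at hcl hmem
      have hc := hmem c (by simp)
      have hd := hmem d (by simp)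
      have he := hmem e (by simp)
      exact hasModel_completeGraph_five_of_clique hu (hS _ ha) (hS _ hc.1) (hS _ hd.1) (hS _ he.1)
        (hA _ ha) (hA _ hc.1) (hA _ hd.1) (hA _ he.1) hc.2.1 hd.2.1 he.2.1
        (hcl c (by simp) d (by simp) hcd) (hcl c (by simp) e (by simp) hce)
        (hcl d (by simp) e (by simp) hde)
    · push Not at hcl
      obtain ⟨c, hc, d, hd, hcd, hncd⟩ := hcl
      obtain ⟨e, he, hce, hde⟩ : ∃ e ∈ ((nbrs G S u).erase a).erase b, c ≠ e ∧ d ≠ e := by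
        by_contra! hcon
        have : ((nbrs G S u).erase a).erase b ⊆ {c, d} := by
          intro x hx
          have := hcon x hx
          simp only [Finset.mem_insert, Finset.mem_singleton]
          tauto
        have := (Finset.card_le_card this).trans Finset.card_le_two
        omega
      have hc := hmem c hc
      have hd := hmem d hd
      have he := hmem e he
      have hec := huniq c hc.1 d hd.1 e he.1 hcd hce hde hncd
      have hed := huniq d hd.1 c hc.1 e he.1 hcd.symm hde hce fun h => hncd h.symm
      apply hasModel_completeGraph_five hu (hS _ hb) (hS _ he.1) (X := {a, c}) (Y := {d})
        (by simp [Set.insert_subset_iff, hS _ ha, hS _ hc.1]) (by simpa using hS _ hd.1)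
        (hA _ hb) (hA _ he.1) he.2.2 (connectedOn_pair hc.2.1) (connectedOn_singleton _ _)
      · simp [hd.2.1.ne, hcd]
      · simp [(hA _ ha).ne, (hA _ hc.1).ne]
      · simp [hab.symm, hc.2.2.ne]
      · simp [he.2.1.ne', hce.symm]
      · simpa using (hA _ hd.1).ne
      · simpa using hd.2.2.ne
      · simpa using hde.symm
      · exact ⟨a, by simp, hA _ ha⟩
      · exact ⟨c, by simp, hc.2.2⟩
      · exact ⟨a, by simp, he.2.1.symm⟩
      · exact ⟨d, by simp, hA _ hd.1⟩
      · exact ⟨d, by simp, hd.2.2⟩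
      · exact ⟨d, by simp, hed.symm⟩
      · exact ⟨a, by simp, d, by simp, hd.2.1⟩

/-- A graph without `K₅` minor on `n ≥ 3` vertices has at most `3 * n - 6` edges. -/
theorem degSum_le_of_not_hasModel (G : SimpleGraph V) (S : Finset V) (hS : 3 ≤ #S)
    (hK : ¬ HasModel (completeGraph (Fin 5)) G S) : degSum G S + 12 ≤ 6 * #S := by
  induction hn : #S generalizing G S with
  | zero => omega
  | succ n ih =>
    rcases Nat.lt_or_ge n 3 with hn3 | hn3
    · have h1 : ∀ x ∈ S, #(nbrs G S x) ≤ 2 := by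
        intro x hx
        have : nbrs G S x ⊆ S.erase x := fun y hy => by
          rw [mem_nbrs] at hy
          exact Finset.mem_erase.2 ⟨hy.2.ne', hy.1⟩
        have := Finset.card_le_card this
        rw [Finset.card_erase_of_mem hx] at this
        omega
      have h2 : degSum G S ≤ #S • 2 := Finset.sum_le_card_nsmul _ _ _ h1
      rw [smul_eq_mul] at h2
      omega
    · induction hm : degSum G S using Nat.strong_induction_on generalizing G with
      | _ m ihm =>
        by_contra hlt
        have hsmall : m ≤ 6 * n - 4 := by
          obtain ⟨x, hx, hxpos⟩ : ∃ x ∈ S, #(nbrs G S x) ≠ 0 := by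
            by_contra! hcon
            have : degSum G S = 0 := Finset.sum_eq_zero hcon
            omega
          obtain ⟨y, hy⟩ := Finset.card_ne_zero.1 hxpos
          rw [mem_nbrs] at hy
          obtain ⟨h1, h2⟩ := degSum_le_deleteEdge hx hy.1 hy.2
          have := ihm _ (hm ▸ h2) (G.deleteEdges {s(x, y)})
            (fun h => hK (h.mono (SimpleGraph.deleteEdges_le _) le_rfl)) rfl
          omega
        obtain ⟨u, hu, hu5⟩ : ∃ u ∈ S, #(nbrs G S u) ≤ 5 := by
          by_contra! hcon
          have : #S • 6 ≤ degSum G S := Finset.card_nsmul_le_sum _ _ _ hcon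
          rw [smul_eq_mul] at this
          omega
        have herase : #(S.erase u) = n := by rw [Finset.card_erase_of_mem hu]; omega
        refine hK (hasModel_of_three_le_common hu ?_ hu5 ?_)
        · have h1 := ih G (S.erase u) (by omega)
            (fun h => hK (h.mono le_rfl (Finset.erase_subset _ _))) herase
          have h2 := degSum_erase G hu
          omega
        · intro v hv
          rw [mem_nbrs] at hv
          have h1 := ih (contractInto G u v) (S.erase u) (by omega)
            (fun h => hK (h.of_contractInto hv.2 hu)) herase
          have h2 := degSum_le_contractInto hu hv.1 hv.2
          omega

lemma two_le_common_of_extremal {G : SimpleGraph V} {S : Finset V}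
    (hK : ¬ HasModel (completeGraph (Fin 5)) G S) (hS : 4 ≤ #S) (hext : 6 * #S ≤ degSum G S + 12)
    {u v : V} (hu : u ∈ S) (hv : v ∈ S) (huv : G.Adj u v) :
    2 ≤ #(nbrs G S u ∩ nbrs G S v) := by
  have herase := Finset.card_erase_of_mem hu
  have h1 := degSum_le_of_not_hasModel (contractInto G u v) (S.erase u) (by omega)
    (fun h => hK (h.of_contractInto huv hu))
  have h2 := degSum_le_contractInto hu hv huv
  omega

lemma not_adj_of_card_nbrs_le_three {G : SimpleGraph V} {S : Finset V}
    (hK : ¬ HasModel (completeGraph (Fin 5)) G S) (hS : 5 ≤ #S) (hext : 6 * #S ≤ degSum G S + 12)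
    {u v : V} (hu : u ∈ S) (hv : v ∈ S) (hu3 : #(nbrs G S u) ≤ 3) (hv3 : #(nbrs G S v) ≤ 3) :
    ¬ G.Adj u v := by
  intro huv
  have hv' : v ∈ S.erase u := Finset.mem_erase.2 ⟨huv.ne', hv⟩
  have h1 := Finset.card_erase_of_mem hu
  have h2 := Finset.card_erase_of_mem hv'
  have h3 := degSum_le_of_not_hasModel G ((S.erase u).erase v) (by omega)
    (fun h => hK (h.mono le_rfl ((Finset.erase_subset _ _).trans (Finset.erase_subset _ _))))
  have h4 := degSum_erase G hu
  have h5 := degSum_erase G hv'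
  have h6 : #(nbrs G (S.erase u) v) < #(nbrs G S v) := by
    refine Finset.card_lt_card ⟨fun y hy => ?_, fun h => ?_⟩
    · rw [mem_nbrs] at hy ⊢
      exact ⟨Finset.mem_of_mem_erase hy.1, hy.2⟩
    · have := h (mem_nbrs.2 ⟨hu, huv.symm⟩)
      simp [mem_nbrs] at this
  omega

/-- Inclusion-exclusion for the edges of a graph covered by two vertex sets. -/
lemma degSum_add_degSum_inter_le {G : SimpleGraph V} {S₁ S₂ : Finset V}
    (hsep : ∀ x ∈ S₁, ∀ y ∈ S₂, G.Adj x y → x ∈ S₂ ∨ y ∈ S₁) :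
    degSum G (S₁ ∪ S₂) + degSum G (S₁ ∩ S₂) ≤ degSum G S₁ + degSum G S₂ := by
  have hpairs : ∀ S : Finset V, degSum G S = #{p ∈ S ×ˢ S | G.Adj p.1 p.2} := by
    intro S
    rw [degSum, Finset.card_filter, Finset.sum_product]
    exact Finset.sum_congr rfl fun x _ => by rw [nbrs, Finset.card_filter]
  simp only [hpairs]
  rw [← Finset.card_union_add_card_inter {p ∈ S₁ ×ˢ S₁ | G.Adj p.1 p.2}]
  refine Nat.add_le_add (Finset.card_le_card ?_) (Finset.card_le_card ?_)
  · rintro ⟨x, y⟩ hxy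
    have h1 := hsep x
    have h2 := hsep y
    have h3 := G.adj_comm x y
    simp only [Finset.mem_filter, Finset.mem_product, Finset.mem_union] at hxy ⊢
    grind
  · rintro ⟨x, y⟩ hxy
    simp only [Finset.mem_filter, Finset.mem_product, Finset.mem_inter] at hxy ⊢
    tauto

/-- The neighbors of `v` are the five distinct vertices `a, b, c, d, e`. -/
structure IsNbhd (G : SimpleGraph V) (v a b c d e : V) : Prop where
  nodup : [a, b, c, d, e].Nodup
  adj_iff : ∀ x, G.Adj v x ↔ x = a ∨ x = b ∨ x = c ∨ x = d ∨ x = e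

/-- The neighborhood of `v` is the induced five-cycle `a b c d e`. -/
structure IsLink (G : SimpleGraph V) (v a b c d e : V) : Prop where
  adj_iff : ∀ x, G.Adj v x ↔ x = a ∨ x = b ∨ x = c ∨ x = d ∨ x = e
  ab : G.Adj a b
  bc : G.Adj b c
  cd : G.Adj c d
  de : G.Adj d e
  ea : G.Adj e a
  ac : ¬ G.Adj a c
  ad : ¬ G.Adj a d
  bd : ¬ G.Adj b d
  be : ¬ G.Adj b e
  ce : ¬ G.Adj c e

lemma IsNbhd.rotate {G : SimpleGraph V} {v a b c d e : V} (h : IsNbhd G v a b c d e) :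
    IsNbhd G v b c d e a := by
  obtain ⟨h1, h2⟩ := h
  constructor <;> grind

lemma IsNbhd.swap {G : SimpleGraph V} {v a b c d e : V} (h : IsNbhd G v a b c d e) :
    IsNbhd G v b a c d e := by
  obtain ⟨h1, h2⟩ := h
  constructor <;> grind

lemma IsNbhd.swap_bc {G : SimpleGraph V} {v a b c d e : V} (h : IsNbhd G v a b c d e) :
    IsNbhd G v a c b d e := by
  obtain ⟨h1, h2⟩ := h
  constructor <;> grind

lemma IsNbhd.swap_cd {G : SimpleGraph V} {v a b c d e : V} (h : IsNbhd G v a b c d e) :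
    IsNbhd G v a b d c e := by
  obtain ⟨h1, h2⟩ := h
  constructor <;> grind

lemma IsNbhd.swap_de {G : SimpleGraph V} {v a b c d e : V} (h : IsNbhd G v a b c d e) :
    IsNbhd G v a b c e d := by
  obtain ⟨h1, h2⟩ := h
  constructor <;> grind

lemma exists_isNbhd {G : SimpleGraph V} [Fintype V] {v : V} (h : #(nbrs G univ v) = 5) :
    ∃ a b c d e, IsNbhd G v a b c d e := by
  obtain ⟨a, s, has, hs, hs4⟩ := Finset.card_eq_succ.1 h
  obtain ⟨b, c, d, e, hbc, hbd, hbe, hcd, hce, hde, rfl⟩ := Finset.card_eq_four.1 hs4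
  refine ⟨a, b, c, d, e, ?_, fun x => ?_⟩
  · simp at has ⊢
    tauto
  · have : x ∈ nbrs G univ v ↔ G.Adj v x := by simp [mem_nbrs]
    rw [← this, ← hs]
    simp

lemma isNbhd_of_nodup {G : SimpleGraph V} [Fintype V] {v a b c d e : V}
    (h : #(nbrs G univ v) = 5) (hnd : [a, b, c, d, e].Nodup) (ha : G.Adj v a) (hb : G.Adj v b)
    (hc : G.Adj v c) (hd : G.Adj v d) (he : G.Adj v e) : IsNbhd G v a b c d e := by
  refine ⟨hnd, fun x => ?_⟩
  have hcard : #([a, b, c, d, e].toFinset) = 5 := List.toFinset_card_of_nodup hnd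
  have hsub : [a, b, c, d, e].toFinset ⊆ nbrs G univ v := by
    intro x hx
    simp only [List.mem_toFinset, List.mem_cons, List.not_mem_nil, or_false] at hx
    rw [mem_nbrs]
    rcases hx with rfl | rfl | rfl | rfl | rfl <;> simp [*]
  have heq := Finset.eq_of_subset_of_card_le hsub (by omega)
  have : x ∈ nbrs G univ v ↔ G.Adj v x := by simp [mem_nbrs]
  rw [← this, ← heq]
  simp

/-- A `5`-regular graph on `12` vertices without `K₅` and `K₃,₃` minors. -/
structure IsFiveRegularPlanar [Fintype V] (G : SimpleGraph V) : Prop where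
  card : Fintype.card V = 12
  regular : ∀ v, #(nbrs G univ v) = 5
  no_k5 : ¬ HasModel (completeGraph (Fin 5)) G univ
  no_k33 : ¬ HasModel (completeBipartiteGraph (Fin 3) (Fin 3)) G univ

namespace IsFiveRegularPlanar

variable [Fintype V] {G : SimpleGraph V} {v a b c d e : V}

lemma degSum_eq (hG : IsFiveRegularPlanar G) : degSum G univ = 60 := by
  simp [degSum, hG.regular, hG.card]

lemma two_le_common (hG : IsFiveRegularPlanar G) (h : G.Adj v a) :
    2 ≤ #(nbrs G univ v ∩ nbrs G univ a) := by
  have h1 := hG.degSum_eq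
  have h2 := hG.card
  rw [← Finset.card_univ] at h2
  exact two_le_common_of_extremal hG.no_k5 (by omega) (by omega) (by simp) (by simp) h

lemma two_nbrs (hG : IsFiveRegularPlanar G) (h : IsNbhd G v a b c d e) :
    (G.Adj a b ∧ G.Adj a c) ∨ (G.Adj a b ∧ G.Adj a d) ∨ (G.Adj a b ∧ G.Adj a e) ∨
      (G.Adj a c ∧ G.Adj a d) ∨ (G.Adj a c ∧ G.Adj a e) ∨ (G.Adj a d ∧ G.Adj a e) := by
  have h2 := hG.two_le_common ((h.adj_iff a).2 (by simp))
  obtain ⟨x, hx, y, hy, hxy⟩ := Finset.one_lt_card.1 h2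
  simp only [Finset.mem_inter, mem_nbrs, Finset.mem_univ, true_and, h.adj_iff] at hx hy
  have := G.loopless.irrefl a
  obtain ⟨hx1, hx2⟩ := hx
  obtain ⟨hy1, hy2⟩ := hy
  rcases hx1 with rfl | rfl | rfl | rfl | rfl <;> rcases hy1 with rfl | rfl | rfl | rfl | rfl <;>
    tauto

lemma not_k23 (hG : IsFiveRegularPlanar G) (h : IsNbhd G v a b c d e) (hac : G.Adj a c)
    (had : G.Adj a d) (hae : G.Adj a e) (hbc : G.Adj b c) (hbd : G.Adj b d) (hbe : G.Adj b e) :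
    False := by
  have hva : G.Adj v a := (h.adj_iff a).2 (by simp)
  have hvb : G.Adj v b := (h.adj_iff b).2 (by simp)
  have hvc : G.Adj v c := (h.adj_iff c).2 (by simp)
  have hvd : G.Adj v d := (h.adj_iff d).2 (by simp)
  have hve : G.Adj v e := (h.adj_iff e).2 (by simp)
  have hnd : [v, a, b, c, d, e].Nodup := by
    have := h.nodup
    have := hva.ne
    have := hvb.ne
    have := hvc.ne
    have := hvd.ne
    have := hve.ne
    grind
  let t : Fin 3 ⊕ Fin 3 → V := Sum.elim ![v, a, b] ![c, d, e]
  have ht : Function.Injective t := by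
    simp only [List.nodup_cons, List.mem_cons, not_or, List.not_mem_nil, or_false] at hnd
    intro i j hij
    rcases i with i | i <;> rcases j with j | j <;> fin_cases i <;> fin_cases j <;>
      simp [t] at hij ⊢ <;> grind
  refine hG.no_k33 ⟨fun w => {t w}, by simp, by simp, fun w => connectedOn_singleton _ _, ?_, ?_⟩
  · rintro w w' hw x rfl hx
    exact hw (ht hx)
  · have hadj : ∀ i j : Fin 3, G.Adj (t (Sum.inl i)) (t (Sum.inr j)) := by
      intro i j
      fin_cases i <;> fin_cases j <;> simp [t, *]
    rintro (i | i) (j | j) hij <;> simp at hij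
    · exact ⟨_, rfl, _, rfl, hadj i j⟩
    · exact ⟨_, rfl, _, rfl, (hadj j i).symm⟩

lemma not_bowtie (hG : IsFiveRegularPlanar G) (h : IsNbhd G v c a b d e) (hca : G.Adj c a)
    (hcb : G.Adj c b) (hcd : G.Adj c d) (hce : G.Adj c e)
    (had : ¬ G.Adj a d) (hae : ¬ G.Adj a e) (hbd : ¬ G.Adj b d) (hbe : ¬ G.Adj b e) : False := by
  have hnd := h.nodup
  have hva : G.Adj v a := (h.adj_iff a).2 (by simp)
  have hvb : G.Adj v b := (h.adj_iff b).2 (by simp)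
  have hvc : G.Adj v c := (h.adj_iff c).2 (by simp)
  have hvd : G.Adj v d := (h.adj_iff d).2 (by simp)
  have hve : G.Adj v e := (h.adj_iff e).2 (by simp)
  have hNc : IsNbhd G c v a b d e := isNbhd_of_nodup (hG.regular c)
    (by
      have := hva.ne
      have := hvb.ne
      have := hvd.ne
      have := hve.ne
      grind) hvc.symm hca hcb hcd hce
  have hcard := hG.card
  rw [← Finset.card_univ] at hcard
  have hdeg := degSum_le_contractInto (Finset.mem_univ v) (Finset.mem_univ b) hvb
  have hcommon : #(nbrs G univ v ∩ nbrs G univ b) ≤ 2 := by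
    refine le_trans (Finset.card_le_card fun x hx => ?_) (Finset.card_le_two (a := a) (b := c))
    simp only [Finset.mem_inter, mem_nbrs, Finset.mem_univ, true_and, h.adj_iff] at hx
    have := G.loopless.irrefl b
    simp only [Finset.mem_insert, Finset.mem_singleton]
    obtain ⟨rfl | rfl | rfl | rfl | rfl, hx⟩ := hx <;> tauto
  rw [hG.degSum_eq] at hdeg
  have herase := Finset.card_erase_of_mem (Finset.mem_univ v)
  have hca' : (contractInto G v b).Adj c a := ⟨hca.ne, Or.inl hca⟩
  have h2 := two_le_common_of_extremal (G := contractInto G v b) (S := univ.erase v)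
    (fun hm => hG.no_k5 (hm.of_contractInto hvb (Finset.mem_univ v))) (by omega) (by omega)
    (by simpa using hvc.ne') (by simpa using hva.ne') hca'
  have h1 : #(nbrs (contractInto G v b) (univ.erase v) c ∩
      nbrs (contractInto G v b) (univ.erase v) a) ≤ #{b} := by
    refine Finset.card_le_card fun x hx => ?_
    simp only [Finset.mem_inter, mem_nbrs, Finset.mem_erase, Finset.mem_univ, and_true,
      contractInto] at hx
    have h3 := hNc.adj_iff x
    rw [Finset.mem_singleton]
    grind
  simp at h1
  omega

/-- A five-cycle around `v` has no chord: the triangle formed by `v` and the chord would separate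
the graph into two parts, one of which would have too few edges. -/
lemma not_chord (hG : IsFiveRegularPlanar G) (h : IsNbhd G v a b c d e) (hab : G.Adj a b)
    (hbc : G.Adj b c) (hcd : G.Adj c d) (hde : G.Adj d e) (hea : G.Adj e a) : ¬ G.Adj a c := by
  intro hac
  have hnd := h.nodup
  have hva : G.Adj v a := (h.adj_iff a).2 (by simp)
  have hvb : G.Adj v b := (h.adj_iff b).2 (by simp)
  have hvc : G.Adj v c := (h.adj_iff c).2 (by simp)
  have hvd : G.Adj v d := (h.adj_iff d).2 (by simp)
  have hve : G.Adj v e := (h.adj_iff e).2 (by simp)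
  have nva := hva.ne
  have nvb := hvb.ne
  have nvc := hvc.ne
  have nvd := hvd.ne
  have nve := hve.ne
  let out : V → Prop := fun x => x ≠ v ∧ x ≠ a ∧ x ≠ c ∧ x ≠ d ∧ x ≠ e
  let A : Set V := {x | Relation.ReflTransGen (fun y z => G.Adj y z ∧ out z) b x}
  have hbA : b ∈ A := Relation.ReflTransGen.refl
  have hAout : ∀ x ∈ A, out x := by
    intro x hx
    rcases Relation.ReflTransGen.cases_tail hx with rfl | ⟨y, -, hy⟩
    · simp only [out]
      grind
    · exact hy.2
  have hAstep : ∀ x ∈ A, ∀ y, G.Adj x y → out y → y ∈ A := fun x hx y hxy hy =>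
    Relation.ReflTransGen.tail hx ⟨hxy, hy⟩
  have hAconn : ConnectedOn G A := by
    rintro P ⟨x, hx, hPx⟩ hprop
    have hb : P b := by
      have hx' := hx
      revert hPx
      induction hx' with
      | refl => exact id
      | tail hy hyz ih => exact fun hz => ih hy (hprop _ hx _ hy hyz.1.symm hz)
    intro y hy
    have hy' := hy
    induction hy' with
    | refl => exact hb
    | tail hw hwz ih => exact hprop _ hw _ hy hwz.1 (ih hw)
  have hAsep : ∀ x ∈ A, ∀ y, G.Adj x y → y ∈ A ∨ y = v ∨ y = a ∨ y = c := by
    intro x hx y hxy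
    by_cases hy : out y
    · exact Or.inl (hAstep x hx y hxy hy)
    right
    by_contra hy'
    have hyde : y = d ∨ y = e := by
      simp only [out] at hy
      tauto
    refine hG.no_k5 (hasModel_completeGraph_five (p := v) (q := a) (r := c) (X := A) (Y := {d, e})
      (by simp) (by simp) (by simp) (by simp) (by simp) hva hvc hac hAconn (connectedOn_pair hde)
      ?_ (fun hv => (hAout _ hv).1 rfl) (fun hv => (hAout _ hv).2.1 rfl)
      (fun hv => (hAout _ hv).2.2.1 rfl) ?_ ?_ ?_ ⟨b, hbA, hvb⟩ ⟨b, hbA, hab⟩ ⟨b, hbA, hbc.symm⟩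
      ⟨d, by simp, hvd⟩ ⟨e, by simp, hea.symm⟩ ⟨d, by simp, hcd⟩ ⟨x, hx, y, hyde, hxy⟩)
    · intro z hz hz'
      have := hAout z hz
      simp only [out] at this
      simp at hz'
      tauto
    · simp [nvd, nve]
    · simp
      grind
    · simp
      grind
  let S₁ : Finset V := {x | x ∈ A ∨ x = v ∨ x = a ∨ x = c}
  let S₂ : Finset V := {x | x ∉ A}
  have mem₁ : ∀ x, x ∈ S₁ ↔ x ∈ A ∨ x = v ∨ x = a ∨ x = c := fun x => by simp [S₁]
  have mem₂ : ∀ x, x ∈ S₂ ↔ x ∉ A := fun x => by simp [S₂]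
  have hvA : v ∉ A := fun hv => (hAout _ hv).1 rfl
  have haA : a ∉ A := fun hv => (hAout _ hv).2.1 rfl
  have hcA : c ∉ A := fun hv => (hAout _ hv).2.2.1 rfl
  have hdA : d ∉ A := fun hv => (hAout _ hv).2.2.2.1 rfl
  have heA : e ∉ A := fun hv => (hAout _ hv).2.2.2.2 rfl
  have hunion : S₁ ∪ S₂ = univ := by
    ext x
    simp only [Finset.mem_union, mem₁, mem₂, Finset.mem_univ, iff_true]
    tauto
  have hinter : S₁ ∩ S₂ = {v, a, c} := by
    ext x
    simp only [Finset.mem_inter, mem₁, mem₂, Finset.mem_insert, Finset.mem_singleton]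
    grind
  have hadd := degSum_add_degSum_inter_le (G := G) (S₁ := S₁) (S₂ := S₂) (by
    intro x hx y hy hxy
    rw [mem₁] at hx ⊢
    rw [mem₂] at hy ⊢
    have := hAsep x
    grind)
  have hcardadd := Finset.card_union_add_card_inter S₁ S₂
  have hT3 : #({v, a, c} : Finset V) = 3 := Finset.card_eq_three.2
    ⟨v, a, c, hva.ne, hvc.ne, hac.ne, rfl⟩
  have hT : 6 ≤ degSum G {v, a, c} := by
    have htwo : ∀ x y z : V, y ≠ z → G.Adj x y → G.Adj x z → y ∈ ({v, a, c} : Finset V) →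
        z ∈ ({v, a, c} : Finset V) → 2 ≤ #(nbrs G {v, a, c} x) := by
      intro x y z hyz hxy hxz hy hz
      rw [← Finset.card_pair hyz]
      refine Finset.card_le_card fun w hw => ?_
      simp only [Finset.mem_insert, Finset.mem_singleton] at hw
      rw [mem_nbrs]
      rcases hw with rfl | rfl <;> exact ⟨by assumption, by assumption⟩
    have : #({v, a, c} : Finset V) • 2 ≤ degSum G {v, a, c} := by
      refine Finset.card_nsmul_le_sum _ _ _ fun x hx => ?_
      simp only [Finset.mem_insert, Finset.mem_singleton] at hx
      rcases hx with rfl | rfl | rfl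
      · exact htwo _ a c hac.ne hva hvc (by simp) (by simp)
      · exact htwo _ v c hvc.ne hva.symm hac (by simp) (by simp)
      · exact htwo _ v a hva.ne hvc.symm hac.symm (by simp) (by simp)
    rw [smul_eq_mul] at this
    omega
  rw [hunion, hinter, hG.degSum_eq] at hadd
  rw [hunion, hinter, Finset.card_univ, hG.card, hT3] at hcardadd
  have hK : ∀ S : Finset V, ¬ HasModel (completeGraph (Fin 5)) G S := fun S hm =>
    hG.no_k5 (hm.mono le_rfl (Finset.subset_univ S))
  have hS₁ : 5 ≤ #S₁ := by
    have hsub : insert b (nbrs G univ b) ⊆ S₁ := by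
      intro x hx
      rw [Finset.mem_insert, mem_nbrs] at hx
      rw [mem₁]
      rcases hx with rfl | hx
      · exact Or.inl hbA
      · exact hAsep b hbA x hx.2
    have h1 := Finset.card_le_card hsub
    rw [Finset.card_insert_of_notMem (by simp [mem_nbrs]), hG.regular] at h1
    omega
  have hS₂ : 5 ≤ #S₂ := by
    have hsub : insert v (([a, c, d, e] : List V).toFinset) ⊆ S₂ := by
      intro x hx
      simp only [Finset.mem_insert, List.mem_toFinset, List.mem_cons, List.not_mem_nil,
        or_false] at hx
      rw [mem₂]
      rcases hx with rfl | rfl | rfl | rfl | rfl <;> assumption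
    have h1 := Finset.card_le_card hsub
    rw [Finset.card_insert_of_notMem (by simp [*]),
      List.toFinset_card_of_nodup (by grind)] at h1
    simpa using h1
  have hb₁ := degSum_le_of_not_hasModel G S₁ (by omega) (hK S₁)
  have hb₂ := degSum_le_of_not_hasModel G S₂ (by omega) (hK S₂)
  have hdeg : ∀ x y z : V, x ∈ ({v, a, c} : Finset V) → (∀ w ∈ ({v, a, c} : Finset V),
      G.Adj x w → w = y ∨ w = z) → #(nbrs G S₁ x) + #(nbrs G S₂ x) ≤ 7 := by
    intro x y z hx hyz
    rw [← Finset.card_union_add_card_inter]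
    have h1 : #(nbrs G S₁ x ∪ nbrs G S₂ x) ≤ 5 := by
      rw [← hG.regular x]
      refine Finset.card_le_card fun w hw => ?_
      simp only [Finset.mem_union, mem_nbrs] at hw ⊢
      simp
      tauto
    have h2 : #(nbrs G S₁ x ∩ nbrs G S₂ x) ≤ 2 := by
      refine le_trans (Finset.card_le_card fun w hw => ?_) (Finset.card_le_two (a := y) (b := z))
      simp only [Finset.mem_inter, mem_nbrs] at hw
      have := hyz w (by rw [← hinter]; simp [hw.1.1, hw.2.1]) hw.1.2
      simpa using this
    omega
  have hdega := hdeg a v c (by simp) (by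
    intro w hw haw
    have := haw.ne
    simp at hw
    grind)
  have hdegc := hdeg c v a (by simp) (by
    intro w hw hcw
    have := hcw.ne
    simp at hw
    grind)
  have hv₁ : #(nbrs G S₁ v) ≤ 3 := by
    refine le_trans (Finset.card_le_card fun w hw => ?_)
      (Finset.card_le_three (a := a) (b := b) (c := c))
    rw [mem_nbrs, mem₁, h.adj_iff] at hw
    simp only [Finset.mem_insert, Finset.mem_singleton]
    grind
  by_cases ha₁ : #(nbrs G S₁ a) ≤ 3
  · exact not_adj_of_card_nbrs_le_three (hK S₁) hS₁ (by omega) (by simp [mem₁]) (by simp [mem₁])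
      hv₁ ha₁ hva
  by_cases hc₁ : #(nbrs G S₁ c) ≤ 3
  · exact not_adj_of_card_nbrs_le_three (hK S₁) hS₁ (by omega) (by simp [mem₁]) (by simp [mem₁])
      hv₁ hc₁ hvc
  exact not_adj_of_card_nbrs_le_three (hK S₂) hS₂ (by omega) ((mem₂ a).2 haA) ((mem₂ c).2 hcA)
    (by omega) (by omega) hac

/-- If `a` has three neighbors in the link of `v`, then no other vertex of the link shares two of
them. -/
lemma not_two_shared (hG : IsFiveRegularPlanar G) (h : IsNbhd G v a b c d e) (hab : G.Adj a b)
    (hac : G.Adj a c) (had : G.Adj a d) (heb : G.Adj e b) (hec : G.Adj e c) : False := by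
  have perm : IsNbhd G v a e b c d := by
    obtain ⟨h1, h2⟩ := h
    constructor <;> grind
  by_cases hed : G.Adj e d
  · exact hG.not_k23 perm hab hac had heb hec hed
  have hd : G.Adj d b ∨ G.Adj d c := by
    have hperm : IsNbhd G v d a b c e := by
      obtain ⟨h1, h2⟩ := h
      constructor <;> grind
    have := hG.two_nbrs hperm
    have := G.adj_comm e d
    tauto
  rcases hd with hd | hd
  · refine hG.not_chord (v := v) (a := a) (b := d) (c := b) (d := e) (e := c) ?_ had hd heb.symm
      hec hac.symm hab
    obtain ⟨h1, h2⟩ := h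
    constructor <;> grind
  · refine hG.not_chord (v := v) (a := a) (b := d) (c := c) (d := e) (e := b) ?_ had hd hec.symm
      heb hab.symm hac
    obtain ⟨h1, h2⟩ := h
    constructor <;> grind

lemma not_center (hG : IsFiveRegularPlanar G) (h : IsNbhd G v a b c d e) (hab : G.Adj a b)
    (hac : G.Adj a c) (had : G.Adj a d) (hae : G.Adj a e) (hbc : G.Adj b c) : False := by
  have hshare : ∀ x y z w, IsNbhd G v a x y z w → G.Adj w x → ¬ G.Adj w y := by
    intro x y z w hperm hwx hwy
    have hall : ∀ t, G.Adj v t → t ≠ a → G.Adj a t := by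
      intro t ht hta
      rw [h.adj_iff] at ht
      rcases ht with rfl | rfl | rfl | rfl | rfl
      · exact absurd rfl hta
      all_goals assumption
    have hnd := hperm.nodup
    refine hG.not_two_shared hperm (hall x ?_ ?_) (hall y ?_ ?_) (hall z ?_ ?_) hwx hwy
    all_goals first | exact (hperm.adj_iff _).2 (by simp) | grind
  refine hG.not_bowtie h hab hac had hae ?_ ?_ ?_ ?_
  · exact hshare c d e b (by obtain ⟨h1, h2⟩ := h; constructor <;> grind) hbc
  · exact hshare c e d b (by obtain ⟨h1, h2⟩ := h; constructor <;> grind) hbc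
  · exact hshare b d e c (by obtain ⟨h1, h2⟩ := h; constructor <;> grind) hbc.symm
  · exact hshare b e d c (by obtain ⟨h1, h2⟩ := h; constructor <;> grind) hbc.symm

lemma not_three (hG : IsFiveRegularPlanar G) (h : IsNbhd G v a b c d e) (hab : G.Adj a b)
    (hac : G.Adj a c) : ¬ G.Adj a d := by
  intro had
  by_cases hae : G.Adj a e
  · have hb := hG.two_nbrs h.swap
    have : G.Adj b c ∨ G.Adj b d ∨ G.Adj b e := by tauto
    rcases this with hbc | hbd | hbe
    · exact hG.not_center h hab hac had hae hbc
    · exact hG.not_center (v := v) (b := b) (c := d) (d := c) (e := e)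
        (by obtain ⟨h1, h2⟩ := h; constructor <;> grind) hab had hac hae hbd
    · exact hG.not_center (v := v) (b := b) (c := e) (d := c) (e := d)
        (by obtain ⟨h1, h2⟩ := h; constructor <;> grind) hab hae hac had hbe
  · have he := hG.two_nbrs h.rotate.rotate.rotate.rotate
    have := G.adj_comm a e
    have : (G.Adj e b ∧ G.Adj e c) ∨ (G.Adj e b ∧ G.Adj e d) ∨ (G.Adj e c ∧ G.Adj e d) := by tauto
    rcases this with ⟨h3, h4⟩ | ⟨h3, h4⟩ | ⟨h3, h4⟩
    · exact hG.not_two_shared h hab hac had h3 h4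
    · exact hG.not_two_shared (v := v) (b := b) (c := d) (d := c)
        (by obtain ⟨h1, h2⟩ := h; constructor <;> grind) hab had hac h3 h4
    · exact hG.not_two_shared (v := v) (b := c) (c := d) (d := b)
        (by obtain ⟨h1, h2⟩ := h; constructor <;> grind) hac had hab h3 h4

lemma exists_isNbhd_adj (hG : IsFiveRegularPlanar G) (v : V) :
    ∃ a b c d e, IsNbhd G v a b c d e ∧ G.Adj a b ∧ G.Adj a c := by
  obtain ⟨a, b, c, d, e, h⟩ := exists_isNbhd (hG.regular v)
  rcases hG.two_nbrs h with h1 | h1 | h1 | h1 | h1 | h1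
  · exact ⟨_, _, _, _, _, h, h1⟩
  · exact ⟨_, _, _, _, _, h.swap_cd, h1⟩
  · exact ⟨_, _, _, _, _, h.swap_de.swap_cd, h1⟩
  · exact ⟨_, _, _, _, _, h.swap_bc.swap_cd, h1⟩
  · exact ⟨_, _, _, _, _, h.swap_bc.swap_de.swap_cd, h1⟩
  · exact ⟨_, _, _, _, _, h.swap_cd.swap_bc.swap_de.swap_cd, h1⟩

lemma isLink_of_isNbhd (hG : IsFiveRegularPlanar G) (h : IsNbhd G v a b c d e) (hab : G.Adj a b)
    (hae : G.Adj a e) (hac : ¬ G.Adj a c) (had : ¬ G.Adj a d) (hbe : ¬ G.Adj b e)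
    (hbc : G.Adj b c) : IsLink G v a b c d e := by
  have hbd : ¬ G.Adj b d := hG.not_three h.swap hab.symm hbc
  have hc := hG.two_nbrs h.rotate.rotate
  have hd := hG.two_nbrs h.rotate.rotate.rotate
  have hce : ¬ G.Adj c e := by
    intro hce
    have hcd : ¬ G.Adj c d :=
      hG.not_three h.rotate.rotate.swap_bc.swap_de.swap_cd.swap_bc hbc.symm hce
    have := G.adj_comm c d
    have := G.adj_comm a d
    have := G.adj_comm b d
    tauto
  have hca := G.adj_comm c a
  have hda := G.adj_comm d a
  have hdb := G.adj_comm d b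
  refine ⟨h.adj_iff, hab, hbc, ?_, ?_, hae.symm, hac, had, hbd, hbe, hce⟩ <;> tauto

/-- In a five-regular planar graph on twelve vertices every neighborhood is a five-cycle. -/
lemma exists_isLink (hG : IsFiveRegularPlanar G) (v : V) :
    ∃ a b c d e, IsLink G v a b c d e := by
  obtain ⟨a, b, e, c, d, h, hab, hae⟩ := hG.exists_isNbhd_adj v
  have hac : ¬ G.Adj a c := hG.not_three h hab hae
  have had : ¬ G.Adj a d := hG.not_three h.swap_de hab hae
  have hN : IsNbhd G v a b c d e := h.swap_cd.swap_de
  have hc := hG.two_nbrs hN.rotate.rotate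
  have hb := hG.two_nbrs hN.rotate
  have hbe : ¬ G.Adj b e := by
    intro hbe
    have h1 : ¬ G.Adj b c := hG.not_three h.swap hab.symm hbe
    have h2 : ¬ G.Adj e c := hG.not_three h.swap_bc.swap hae.symm hbe.symm
    have := G.adj_comm c a
    have := G.adj_comm c b
    have := G.adj_comm c e
    tauto
  by_cases hbc : G.Adj b c
  · exact ⟨_, _, _, _, _, hG.isLink_of_isNbhd hN hab hae hac had hbe hbc⟩
  · exact ⟨_, _, _, _, _, hG.isLink_of_isNbhd hN.swap_cd hab hae had hac hbe (by tauto)⟩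

end IsFiveRegularPlanar

namespace IsLink

variable {G : SimpleGraph V} {v a b c d e x y z : V}

lemma rotate (h : IsLink G v a b c d e) : IsLink G v b c d e a where
  adj_iff x := by rw [h.adj_iff]; tauto
  ab := h.bc
  bc := h.cd
  cd := h.de
  de := h.ea
  ea := h.ab
  ac := h.bd
  ad := h.be
  bd := h.ce
  be := fun h' => h.ac h'.symm
  ce := fun h' => h.ad h'.symm

lemma reflect (h : IsLink G v a b c d e) : IsLink G v b a e d c where
  adj_iff x := by rw [h.adj_iff]; tauto
  ab := h.ab.symm
  bc := h.ea.symm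
  cd := h.de.symm
  de := h.cd.symm
  ea := h.bc.symm
  ac := h.be
  ad := h.bd
  bd := h.ad
  be := h.ac
  ce := fun h' => h.ce h'.symm

lemma adj_a (h : IsLink G v a b c d e) : G.Adj v a := (h.adj_iff a).2 (by simp)

lemma adj_b (h : IsLink G v a b c d e) : G.Adj v b := h.rotate.adj_a

lemma adj_e (h : IsLink G v a b c d e) : G.Adj v e := h.rotate.rotate.rotate.rotate.adj_a

lemma eq_of_adj (h : IsLink G v a b c d e) (hz : G.Adj v z) (haz : G.Adj a z) (hzb : z ≠ b) :
    z = e := by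
  rcases (h.adj_iff z).1 hz with rfl | rfl | rfl | rfl | rfl
  · exact absurd haz (G.loopless.irrefl _)
  · exact absurd rfl hzb
  · exact absurd haz h.ac
  · exact absurd haz h.ad
  · rfl

lemma start_at (h : IsLink G v a b c d e) (hx : G.Adj v x) : ∃ p q r s, IsLink G v x p q r s := by
  rcases (h.adj_iff x).1 hx with rfl | rfl | rfl | rfl | rfl
  · exact ⟨_, _, _, _, h⟩
  · exact ⟨_, _, _, _, h.rotate⟩
  · exact ⟨_, _, _, _, h.rotate.rotate⟩
  · exact ⟨_, _, _, _, h.rotate.rotate.rotate⟩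
  · exact ⟨_, _, _, _, h.rotate.rotate.rotate.rotate⟩

lemma start_at_edge (h : IsLink G v a b c d e) (hx : G.Adj v x) (hy : G.Adj v y)
    (hxy : G.Adj x y) : ∃ p q r, IsLink G v x y p q r := by
  obtain ⟨p, q, r, s, h'⟩ := h.start_at hx
  by_cases hyp : y = p
  · exact ⟨_, _, _, hyp ▸ h'⟩
  · obtain rfl := h'.eq_of_adj hy hxy hyp
    exact ⟨_, _, _, h'.reflect.rotate⟩

/-- Three consecutive vertices of a link can be put at its start. -/
lemma start_at_path (h : IsLink G v a b c d e) (hx : G.Adj v x) (hy : G.Adj v y) (hz : G.Adj v z)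
    (hxy : G.Adj x y) (hyz : G.Adj y z) (hxz : x ≠ z) : ∃ p q, IsLink G v x y z p q := by
  obtain ⟨p, q, r, h'⟩ := h.start_at_edge hy hx hxy.symm
  obtain rfl := h'.eq_of_adj hz hyz hxz.symm
  exact ⟨_, _, h'.reflect⟩

lemma nodup (h : IsLink G v a b c d e) : [a, b, c, d, e].Nodup := by
  obtain ⟨-, h1, h2, h3, h4, h5, h6, h7, h8, h9, h10⟩ := h
  simp only [List.nodup_cons, List.mem_cons, List.not_mem_nil, or_false, not_or,
    not_false_eq_true, List.nodup_nil, and_true]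
  refine ⟨⟨h1.ne, ?_, ?_, h5.ne'⟩, ⟨h2.ne, ?_, ?_⟩, ⟨h3.ne, ?_⟩, h4.ne⟩
  · rintro rfl; exact h7 h3
  · rintro rfl; exact h6 h3.symm
  · rintro rfl; exact h9 h4
  · rintro rfl; exact h8 h4.symm
  · rintro rfl; exact h6 h5.symm

lemma ac_ne (h : IsLink G v a b c d e) : a ≠ c := by
  rintro rfl
  exact h.ad h.cd

/-- The links of the two ends of an edge `v c` agree on the triangles through that edge. -/
lemma eq_of_isLink {p q r s : V} (h : IsLink G v a b c p q) (h' : IsLink G c v b d r s) : s = p :=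
  h.reflect.rotate.rotate.rotate.rotate.eq_of_adj h'.ea.symm h'.adj_e
    h'.rotate.rotate.rotate.rotate.ac_ne

end IsLink

lemma nonempty_iso_ic_of_labelling [Fintype V] {G : SimpleGraph V} (hcard : Fintype.card V = 12)
    {v0 v1 v2 v3 v4 v5 w6 w7 w8 w9 w10 z : V} (h0 : IsLink G v0 v5 v1 v2 v3 v4)
    (h1 : IsLink G v1 v5 v0 v2 w7 w6) (h2 : IsLink G v2 v1 v0 v3 w8 w7)
    (h3 : IsLink G v3 v2 v0 v4 w9 w8) (h4 : IsLink G v4 v3 v0 v5 w10 w9)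
    (h5 : IsLink G v5 v4 v0 v1 w6 w10) (h6 : IsLink G w6 w10 v5 v1 w7 z)
    (h7 : IsLink G w7 w6 v1 v2 w8 z) (h8 : IsLink G w8 w7 v2 v3 w9 z)
    (h9 : IsLink G w9 w8 v3 v4 w10 z) (h10 : IsLink G w10 w9 v4 v5 w6 z)
    (h11 : IsLink G z w7 w8 w9 w10 w6) : Nonempty (G ≃g Ic) := by
  let g : Fin 12 → V := ![v0, v1, v2, v3, v4, v5, w6, w7, w8, w9, w10, z]
  have hinj : Function.Injective g := by
    have e1 : v0 ≠ z := fun h => h1.bd (h ▸ h7.adj_e.symm)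
    have e2 : v1 ≠ w9 := fun h => h2.ad (h ▸ h8.rotate.rotate.rotate.adj_a.symm)
    have e3 : v2 ≠ w10 := fun h => h3.ad (h ▸ h9.rotate.rotate.rotate.adj_a.symm)
    have e4 : v3 ≠ w6 := fun h => h4.ad (h ▸ h10.rotate.rotate.rotate.adj_a.symm)
    have e5 : v4 ≠ w7 := fun h => h5.ad (h ▸ h6.rotate.rotate.rotate.adj_a.symm)
    have e6 : v5 ≠ w8 := fun h => h1.ad (h ▸ h7.rotate.rotate.rotate.adj_a.symm)
    have n0 := h0.nodup
    have n1 := h1.nodup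
    have n2 := h2.nodup
    have n3 := h3.nodup
    have n4 := h4.nodup
    have n5 := h5.nodup
    have n6 := h6.nodup
    have n7 := h7.nodup
    have n8 := h8.nodup
    have n9 := h9.nodup
    have n10 := h10.nodup
    have n11 := h11.nodup
    rw [← List.nodup_ofFn]
    change [v0, v1, v2, v3, v4, v5, w6, w7, w8, w9, w10, z].Nodup
    clear h0 h1 h2 h3 h4 h5 h6 h7 h8 h9 h10 h11
    simp only [List.nodup_cons, List.mem_cons, List.not_mem_nil, or_false, not_or,
      not_false_eq_true, List.nodup_nil, and_true, eq_comm, ne_eq] at *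
    simp only [*, not_false_eq_true, and_self]
  have hnbr : ∀ i x, G.Adj (g i) x ↔ ∃ j, Ic.Adj i j ∧ g j = x := by
    intro i x
    fin_cases i
    all_goals
      simp [g, Ic, icList, Fin.exists_fin_succ, h0.adj_iff, h1.adj_iff, h2.adj_iff, h3.adj_iff,
        h4.adj_iff, h5.adj_iff, h6.adj_iff, h7.adj_iff, h8.adj_iff, h9.adj_iff, h10.adj_iff,
        h11.adj_iff, eq_comm (b := x)]
      tauto
  have hbij : Function.Bijective g :=
    (Fintype.bijective_iff_injective_and_card g).2 ⟨hinj, by simp [hcard]⟩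
  refine ⟨RelIso.symm ⟨Equiv.ofBijective g hbij, fun {i j} => ?_⟩⟩
  rw [Equiv.ofBijective_apply, Equiv.ofBijective_apply, hnbr]
  exact ⟨fun ⟨k, hk, hkj⟩ => hinj hkj ▸ hk, fun h => ⟨j, h, rfl⟩⟩

/-- A graph on twelve vertices all of whose neighborhoods are five-cycles is the icosahedron. -/
lemma nonempty_iso_ic_of_isLink [Fintype V] {G : SimpleGraph V} (hcard : Fintype.card V = 12)
    (hG : ∀ v, ∃ a b c d e, IsLink G v a b c d e) : Nonempty (G ≃g Ic) := by
  have : Nonempty V := Fintype.card_pos_iff.1 (by omega)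
  obtain ⟨v0⟩ := this
  have path : ∀ {v x y z}, G.Adj v x → G.Adj v y → G.Adj v z → G.Adj x y → G.Adj y z → x ≠ z →
      ∃ p q, IsLink G v x y z p q := by
    intro v x y z h1 h2 h3 h4 h5 h6
    obtain ⟨a, b, c, d, e, h⟩ := hG v
    exact h.start_at_path h1 h2 h3 h4 h5 h6
  obtain ⟨v1, v2, v3, v4, v5, h0⟩ := hG v0
  obtain ⟨t, w6, h1⟩ := path h0.ea.symm h0.adj_a.symm h0.ab h0.adj_e.symm h0.adj_b
    h0.rotate.rotate.rotate.rotate.ac_ne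
  replace h0 := h0.rotate
  obtain ⟨t, w7, h2⟩ := path h0.ea.symm h0.adj_a.symm h0.ab h0.adj_e.symm h0.adj_b
    h0.rotate.rotate.rotate.rotate.ac_ne
  obtain rfl := h1.eq_of_isLink h2
  replace h0 := h0.rotate
  obtain ⟨t, w8, h3⟩ := path h0.ea.symm h0.adj_a.symm h0.ab h0.adj_e.symm h0.adj_b
    h0.rotate.rotate.rotate.rotate.ac_ne
  obtain rfl := h2.eq_of_isLink h3
  replace h0 := h0.rotate
  obtain ⟨t, w9, h4⟩ := path h0.ea.symm h0.adj_a.symm h0.ab h0.adj_e.symm h0.adj_b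
    h0.rotate.rotate.rotate.rotate.ac_ne
  obtain rfl := h3.eq_of_isLink h4
  replace h0 := h0.rotate
  obtain ⟨t, w10, h5⟩ := path h0.ea.symm h0.adj_a.symm h0.ab h0.adj_e.symm h0.adj_b
    h0.rotate.rotate.rotate.rotate.ac_ne
  obtain rfl := h4.eq_of_isLink h5
  obtain rfl := h5.eq_of_isLink h1
  have ring : ∀ {c x y z s t r}, IsLink G x t c y s r → ∀ {w}, IsLink G y x c z w s →
      ∃ u, IsLink G s r x y w u := by
    intro c x y z s t r h w h'
    obtain ⟨p, u, hs⟩ := path h.de h.rotate.rotate.rotate.adj_a.symm h.cd.symm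
      h.adj_e.symm h.rotate.rotate.adj_a h.rotate.rotate.ac_ne.symm
    obtain rfl := h'.reflect.eq_of_isLink hs.reflect.rotate.rotate.rotate.rotate
    exact ⟨u, hs⟩
  obtain ⟨z, h7⟩ := ring h1 h2
  obtain ⟨s, h8⟩ := ring h2 h3
  obtain rfl := h7.rotate.eq_of_isLink h8
  obtain ⟨z, h9⟩ := ring h3 h4
  obtain rfl := h8.rotate.eq_of_isLink h9
  obtain ⟨z, h10⟩ := ring h4 h5
  obtain rfl := h9.rotate.eq_of_isLink h10
  obtain ⟨z, h6⟩ := ring h5 h1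
  obtain rfl := h10.rotate.eq_of_isLink h6
  obtain ⟨t, t', h11⟩ := path (v := z) (x := w7) (y := w8) (z := w9) h7.adj_e.symm h8.adj_e.symm
    h9.adj_e.symm h8.adj_a.symm h9.adj_a.symm h8.rotate.rotate.rotate.ac_ne.symm
  obtain rfl := h7.rotate.rotate.eq_of_isLink h11
  obtain rfl := h9.reflect.eq_of_isLink h11.reflect.rotate.rotate.rotate.rotate
  exact nonempty_iso_ic_of_labelling hcard h0 h1 h2 h3 h4 h5 h6 h7 h8 h9 h10 h11

/-- If deleting `a` from a graph on thirteen vertices with minimum degree at least six leaves a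
planar graph, then that planar graph is five-regular. -/
lemma isFiveRegularPlanar_of_isPlanar {G : SimpleGraph (Fin 13)} (hdeg : ∀ v, 6 ≤ vdeg G v)
    {a : Fin 13} (h : IsPlanar (G.induce {u | u ≠ a})) :
    IsFiveRegularPlanar (G.induce {u | u ≠ a}) ∧ ∀ u, u ≠ a → G.Adj a u := by
  set H := G.induce {u | u ≠ a} with hH
  have hcard : Fintype.card {u : Fin 13 | u ≠ a} = 12 := by
    rw [Set.card_ne_eq]
    rfl
  have hK5 : ¬ HasModel (completeGraph (Fin 5)) H univ := fun hM => h.1 hM.isMinor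
  have hK33 : ¬ HasModel (completeBipartiteGraph (Fin 3) (Fin 3)) H univ :=
    fun hM => h.2 hM.isMinor
  have hvdeg (u : {u : Fin 13 | u ≠ a}) :
      vdeg G u = #(nbrs H univ u) + if G.Adj a u then 1 else 0 := by
    have hmap : #(nbrs H univ u) = #((G.neighborFinset u).erase a) := by
      rw [← Finset.card_map (Function.Embedding.subtype _)]
      congr 1
      ext x
      simp only [mem_map, mem_nbrs, mem_univ, true_and, hH, SimpleGraph.comap_adj, mem_erase,
        SimpleGraph.mem_neighborFinset]
      constructor
      · rintro ⟨y, hy, rfl⟩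
        exact ⟨y.2, hy⟩
      · rintro ⟨hx, hy⟩
        exact ⟨⟨x, hx⟩, hy, rfl⟩
    have hv : vdeg G u = #(G.neighborFinset u) := by
      rw [vdeg, Set.ncard_eq_toFinset_card']
      rfl
    rw [hv, hmap]
    split_ifs with hau
    · exact (Finset.card_erase_add_one (by simpa using hau.symm)).symm
    · rw [Finset.erase_eq_of_notMem (by simpa using fun h => hau h.symm), add_zero]
  have hge (u) : 5 ≤ #(nbrs H univ u) := by
    have := hdeg u
    have := hvdeg u
    split_ifs at this <;> omega
  have hle : degSum H univ ≤ 60 := by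
    have := degSum_le_of_not_hasModel H univ (by rw [card_univ, hcard]; norm_num) hK5
    rw [card_univ, hcard] at this
    omega
  have hreg (u) : #(nbrs H univ u) = 5 := by
    refine ((Finset.sum_eq_sum_iff_of_le fun u _ => hge u).1 (le_antisymm
      (Finset.sum_le_sum fun u _ => hge u) (hle.trans ?_)) u (mem_univ u)).symm
    simp [hcard]
  refine ⟨⟨hcard, hreg, hK5, hK33⟩, fun u hu => ?_⟩
  have h1 := hdeg u
  have h2 := hvdeg ⟨u, hu⟩
  rw [hreg] at h2
  by_contra hau
  simp only [hau, if_false] at h2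
  omega

lemma nonempty_iso_coneIc {W : Type} {G : SimpleGraph W} {a : W} (ha : ∀ u, u ≠ a → G.Adj a u)
    (φ : G.induce {u | u ≠ a} ≃g Ic) : Nonempty (G ≃g ConeIc) := by
  let g : Unit ⊕ Fin 12 → W := Sum.elim (fun _ => a) fun i => φ.symm i
  have hne (i) : (φ.symm i : W) ≠ a := (φ.symm i).2
  have hbij : Function.Bijective g := by
    constructor
    · rintro (_ | i) (_ | j) hij
      · rfl
      · exact absurd hij.symm (hne j)
      · exact absurd hij (hne i)
      · exact congrArg _ (φ.symm.injective (Subtype.ext hij))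
    · intro x
      by_cases hx : x = a
      · exact ⟨Sum.inl (), hx.symm⟩
      · exact ⟨Sum.inr (φ ⟨x, hx⟩), by simp [g]⟩
  refine ⟨RelIso.symm ⟨Equiv.ofBijective g hbij, fun {i j} => ?_⟩⟩
  rw [Equiv.ofBijective_apply, Equiv.ofBijective_apply]
  rcases i with _ | i <;> rcases j with _ | j
  · simp [g, ConeIc]
  · simpa [g, ConeIc] using ha _ (hne j)
  · simpa [g, ConeIc] using (ha _ (hne i)).symm
  · have h1 : G.Adj (φ.symm i) (φ.symm j) ↔ Ic.Adj i j := φ.symm.map_adj_iff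
    have h2 := Ic.adj_comm i j
    have h3 : Ic.Adj i j → i ≠ j := fun h => h.ne
    simp only [g, ConeIc, Sum.elim_inr, SimpleGraph.fromRel_adj, ne_eq, Sum.inr.injEq,
      reduceCtorEq, false_or, exists_and_left, exists_eq_left']
    rw [h1]
    tauto

end Density

/-- An apex graph on 13 vertices with minimum degree at least 6 is isomorphic
to the join `K₁ ∗ Ic`. -/
theorem stmt_8 (G : SimpleGraph (Fin 13)) (hdeg : ∀ v, 6 ≤ vdeg G v) (h : IsApex G) :
    Nonempty (G ≃g ConeIc) := by
  obtain ⟨a, ha⟩ := h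
  obtain ⟨hreg, hadj⟩ := isFiveRegularPlanar_of_isPlanar hdeg ha
  obtain ⟨φ⟩ := nonempty_iso_ic_of_isLink hreg.card hreg.exists_isLink
  exact nonempty_iso_coneIc hadj φ
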